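/- (Theorem 1(ii)) Let e be an empirical model on a measurement scenario (X, M, O) with CF(e) > 0. Then there exist real coefficients a = (a[C,s])_{C∈M, s∈O^C} such that: a·e' ≤ 0 for every non-contextual empirical model e' (so (a, 0) is a Bell inequality); ‖a‖ = 1; and a·e = CF(e). In particular, the normalized violation of the Bell inequality (a, 0) by e equals CF(e). -/

import Mathlib

open Finset

/-- Assignments of outcomes in `O` to the measurements in a context `C`. -/
abbrev Assign {X : Type} (C : Finset X) (O : Type) : Type := {x // x ∈ C} → O

variable {X O : Type} [Fintype X] [DecidableEq X] [Fintype O] [DecidableEq O]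

/-- Marginalisation of a distribution on assignments on `C` to a subset `U ⊆ C`. -/
noncomputable def marg {C U : Finset X} (h : U ⊆ C) (d : Assign C O → ℝ) :
    Assign U O → ℝ :=
  fun t => ∑ s ∈ univ.filter
    (fun s : Assign C O => ∀ u : {x // x ∈ U}, s ⟨u.1, h u.2⟩ = t u), d s

/-- Marginalisation of a distribution on global assignments to a context `C`. -/
noncomputable def margG (C : Finset X) (d : (X → O) → ℝ) : Assign C O → ℝ :=
  fun t => ∑ g ∈ univ.filter (fun g : X → O => ∀ x : {x // x ∈ C}, g x.1 = t x), d g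

/-- `d` is a probability distribution on the finite type `α`. -/
def IsProb {α : Type} [Fintype α] (d : α → ℝ) : Prop :=
  (∀ a, 0 ≤ d a) ∧ ∑ a, d a = 1

/-- An empirical model on the scenario `(X, M, O)`: a probability distribution on each
context of `M`, compatible on overlaps. -/
def IsEmpiricalModel (M : Finset (Finset X)) (e : ∀ C : Finset X, Assign C O → ℝ) : Prop :=
  (∀ C ∈ M, IsProb (e C)) ∧
  ∀ C ∈ M, ∀ C' ∈ M,
    marg (inter_subset_left : C ∩ C' ⊆ C) (e C) =
    marg (inter_subset_right : C ∩ C' ⊆ C') (e C')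

/-- A model is non-contextual if it is the marginalisation of a probability
distribution on global assignments. -/
def NonContextual (M : Finset (Finset X)) (e : ∀ C : Finset X, Assign C O → ℝ) : Prop :=
  ∃ d : (X → O) → ℝ, IsProb d ∧ ∀ C ∈ M, margG C d = e C

/-- A model is strongly contextual if no global assignment is consistent with its support. -/
def StronglyContextual (M : Finset (Finset X)) (e : ∀ C : Finset X, Assign C O → ℝ) : Prop :=
  ¬ ∃ g : X → O, ∀ C ∈ M, 0 < e C (fun x => g x.1)

/-- `b` is a subprobability distribution on global assignments whose marginals are
  dominated by the empirical model `e`. -/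
def Feasible (M : Finset (Finset X)) (e : ∀ C : Finset X, Assign C O → ℝ)
    (b : (X → O) → ℝ) : Prop :=
  (∀ g, 0 ≤ b g) ∧ (∑ g, b g) ≤ 1 ∧ ∀ C ∈ M, ∀ t, margG C b t ≤ e C t

/-- The non-contextual fraction: the maximum weight of a subprobability distribution on
global assignments dominated by `e`. -/
noncomputable def NCF (M : Finset (Finset X)) (e : ∀ C : Finset X, Assign C O → ℝ) : ℝ :=
  sSup {w | ∃ b : (X → O) → ℝ, Feasible M e b ∧ ∑ g, b g = w}

/-- The contextual fraction. -/
noncomputable def CF (M : Finset (Finset X)) (e : ∀ C : Finset X, Assign C O → ℝ) : ℝ :=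
  1 - NCF M e

/-- The pairing `a·e` between inequality coefficients and an empirical model. -/
def dotM {X O : Type} [Fintype X] [DecidableEq X] [Fintype O] [DecidableEq O]
    (M : Finset (Finset X)) (a e : ∀ C : Finset X, Assign C O → ℝ) : ℝ :=
  ∑ C ∈ M, ∑ s, a C s * e C s

/-- The algebraic bound `‖a‖ = Σ_C max_s a[C,s]` of a system of coefficients. -/
noncomputable def normM {X O : Type} [Fintype X] [DecidableEq X] [Fintype O] [DecidableEq O]
    [Nonempty O] (M : Finset (Finset X)) (a : ∀ C : Finset X, Assign C O → ℝ) : ℝ :=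
  ∑ C ∈ M, (univ : Finset (Assign C O)).sup' univ_nonempty (a C)

/-- Restriction of a global assignment to a context. -/
def restrictTo (C : Finset X) (g : X → O) : Assign C O := fun x => g x.1

lemma margG_apply (C : Finset X) (d : (X → O) → ℝ) (t : Assign C O) :
    margG C d t = ∑ g, if restrictTo C g = t then d g else 0 := by
  simp only [margG, sum_filter, funext_iff, restrictTo]

lemma sum_mul_margG (C : Finset X) (d : (X → O) → ℝ) (y : Assign C O → ℝ) :
    ∑ s, y s * margG C d s = ∑ g, d g * y (restrictTo C g) := by
  simp only [margG_apply, mul_sum, mul_ite, mul_zero]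
  rw [sum_comm]
  simp [mul_comm]

lemma sum_margG (C : Finset X) (d : (X → O) → ℝ) : ∑ s, margG C d s = ∑ g, d g := by
  simpa using sum_mul_margG C d 1

lemma dotM_margG (M : Finset (Finset X)) (y : ∀ C : Finset X, Assign C O → ℝ)
    (d : (X → O) → ℝ) :
    dotM M y (fun C => margG C d) = ∑ g, d g * ∑ C ∈ M, y C (restrictTo C g) := by
  simp only [dotM, sum_mul_margG, mul_sum]
  exact sum_comm

lemma dotM_mono_right {M : Finset (Finset X)} {y e e' : ∀ C : Finset X, Assign C O → ℝ}
    (hy : ∀ C s, 0 ≤ y C s) (h : ∀ C ∈ M, ∀ s, e C s ≤ e' C s) :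
    dotM M y e ≤ dotM M y e' :=
  sum_le_sum fun C hC => sum_le_sum fun s _ => mul_le_mul_of_nonneg_left (h C hC s) (hy C s)

lemma dotM_const_sub {M : Finset (Finset X)} {e : ∀ C : Finset X, Assign C O → ℝ}
    (he : ∀ C ∈ M, ∑ s, e C s = 1) (k : Finset X → ℝ) (y : ∀ C : Finset X, Assign C O → ℝ) :
    dotM M (fun C s => k C - y C s) e = ∑ C ∈ M, k C - dotM M y e := by
  simp only [dotM, sub_mul, sum_sub_distrib, ← mul_sum]
  congr 1
  exact sum_congr rfl fun C hC => by rw [he C hC, mul_one]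

/-- Feasible points of the linear program dual to the one defining `NCF`. -/
def DualFeasible (M : Finset (Finset X)) (y : ∀ C : Finset X, Assign C O → ℝ) : Prop :=
  (∀ C s, 0 ≤ y C s) ∧ ∀ g : X → O, 1 ≤ ∑ C ∈ M, y C (restrictTo C g)

lemma DualFeasible.sum_le_dotM {M : Finset (Finset X)} {y e : ∀ C : Finset X, Assign C O → ℝ}
    (hy : DualFeasible M y) {b : (X → O) → ℝ} (hb : ∀ g, 0 ≤ b g)
    (hbe : ∀ C ∈ M, ∀ t, margG C b t ≤ e C t) : ∑ g, b g ≤ dotM M y e :=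
  calc ∑ g, b g ≤ ∑ g, b g * ∑ C ∈ M, y C (restrictTo C g) :=
        sum_le_sum fun g _ => le_mul_of_one_le_right (hb g) (hy.2 g)
    _ = dotM M y (fun C => margG C b) := (dotM_margG M y b).symm
    _ ≤ dotM M y e := dotM_mono_right hy.1 hbe

/-- Every continuous linear functional on families of weights is a pairing with coefficients. -/
lemma exists_coeff_of_continuousLinearMap
    (f : (∀ C : Finset X, Assign C O → ℝ) →L[ℝ] ℝ) :
    ∃ c : ∀ C : Finset X, Assign C O → ℝ, ∀ z, f z = dotM univ c z := by
  refine ⟨fun C s => f (Pi.single C (Pi.single s 1)), fun z => ?_⟩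
  have hz : z = ∑ C, ∑ s, z C s • Pi.single C (Pi.single s (1 : ℝ)) := by
    ext C s
    simp only [Finset.sum_apply, Pi.smul_apply, smul_eq_mul]
    rw [sum_eq_single C, sum_eq_single s]
    · simp
    · intro t _ ht
      simp [Pi.single_eq_of_ne ht.symm]
    · simp
    · intro D _ hD
      simp [Pi.single_eq_of_ne hD.symm]
    · simp
  conv_lhs => rw [hz]
  simp only [map_sum, map_smul, smul_eq_mul, dotM]
  exact sum_congr rfl fun C _ => sum_congr rfl fun s _ => mul_comm _ _

lemma dotM_univ_ite (M : Finset (Finset X)) (c z : ∀ C : Finset X, Assign C O → ℝ) :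
    dotM univ c (fun C s => if C ∈ M then z C s else 0) = dotM M c z := by
  simp only [dotM, mul_ite, mul_zero]
  rw [← sum_subset (subset_univ M)]
  · exact sum_congr rfl fun C hC => by simp [hC]
  · intro C _ hC
    simp [hC]

/-- Separation step of linear programming duality. -/
lemma exists_dualFeasible_dotM_le [Nonempty O] {M : Finset (Finset X)}
    {e : ∀ C : Finset X, Assign C O → ℝ} (he : ∀ C ∈ M, ∀ s, 0 ≤ e C s) {w : ℝ} (hw : 0 < w)
    (h : ∀ b : (X → O) → ℝ, (∀ g, 0 ≤ b g) → (∀ C ∈ M, ∀ t, margG C b t ≤ e C t) →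
      ∑ g, b g < w) :
    ∃ y, DualFeasible M y ∧ dotM M y e ≤ w := by
  let L : ((X → O) → ℝ) →ₗ[ℝ] (∀ C : Finset X, Assign C O → ℝ) :=
    { toFun := fun d C s => if C ∈ M then margG C d s else 0
      map_add' := by
        intro d d'
        ext C s
        by_cases hC : C ∈ M <;> simp [hC, margG, sum_add_distrib]
      map_smul' := by
        intro r d
        ext C s
        by_cases hC : C ∈ M <;> simp [hC, margG, mul_sum] }
  have hL (d) : L d = fun C s => if C ∈ M then margG C d s else 0 := rfl
  let e' : ∀ C : Finset X, Assign C O → ℝ := fun C s => if C ∈ M then e C s else 0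
  have hdisj : Disjoint ((w • L) '' stdSimplex ℝ (X → O)) (Set.Iic e') := by
    rw [Set.disjoint_left]
    rintro _ ⟨d, hd, rfl⟩ hle
    have := h (w • d) (fun g => mul_nonneg hw.le (hd.1 g)) (fun C hC t => by
      have h1 := hle C t
      rw [LinearMap.smul_apply, ← map_smul, hL] at h1
      simpa [e', hC] using h1)
    simp [← mul_sum, hd.2] at this
  obtain ⟨f, u, v, hfu, huv, hfv⟩ := geometric_hahn_banach_compact_closed
    ((convex_stdSimplex ℝ (X → O)).linear_image (w • L))
    ((isCompact_stdSimplex ℝ (X → O)).image (LinearMap.continuous_of_finiteDimensional _))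
    (convex_Iic e') isClosed_Iic hdisj
  obtain ⟨c, hc⟩ := exists_coeff_of_continuousLinearMap (-f)
  have hfe : dotM M c e < -v := by
    have h1 := hfv e' (Set.mem_Iic.2 le_rfl)
    have h2 := hc e'
    rw [dotM_univ_ite] at h2
    rw [← h2, neg_apply]
    linarith
  have hc0 : ∀ C s, 0 ≤ c C s := by
    intro C s
    by_contra! hneg
    let x : ∀ C : Finset X, Assign C O → ℝ := Pi.single C (Pi.single s 1)
    have hfx : f x = -c C s := by
      have h1 := hc x
      have h2 : dotM univ c x = c C s := by
        simp only [dotM, x]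
        rw [sum_eq_single C, sum_eq_single s]
        · simp
        · intro t _ ht
          simp [Pi.single_eq_of_ne ht]
        · simp
        · intro D _ hD
          simp [Pi.single_eq_of_ne hD]
        · simp
      rw [h2, neg_apply] at h1
      linarith
    have hv' := hfv e' (Set.mem_Iic.2 le_rfl)
    have hx0 : 0 ≤ x := by
      simp only [x, Pi.single_nonneg]
      exact zero_le_one
    have ht : 0 ≤ (f e' - v) / (-c C s) := div_nonneg (by linarith) (by linarith)
    have h3 := hfv (e' - ((f e' - v) / (-c C s)) • x)
      (Set.mem_Iic.2 (sub_le_self _ (smul_nonneg ht hx0)))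
    rw [map_sub, map_smul, hfx, smul_eq_mul, div_mul_cancel₀ _ (by linarith)] at h3
    linarith
  have hpos : 0 < -v := lt_of_le_of_lt
    (sum_nonneg fun C hC => sum_nonneg fun s _ => mul_nonneg (hc0 C s) (he C hC s)) hfe
  have hcol (g : X → O) : -v ≤ w * ∑ C ∈ M, c C (restrictTo C g) := by
    have h1 := hfu _ ⟨Pi.single g 1, single_mem_stdSimplex ℝ g, rfl⟩
    have h2 := hc (L (Pi.single g 1))
    rw [hL, dotM_univ_ite, dotM_margG, sum_eq_single g (by
      intro g' _ hg'
      simp [Pi.single_eq_of_ne hg']) (by simp), Pi.single_eq_same, one_mul] at h2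
    rw [← h2, ← hL, neg_apply]
    rw [LinearMap.smul_apply, map_smul, smul_eq_mul] at h1
    linarith
  refine ⟨fun C s => w / (-v) * c C s, ⟨fun C s => by have := hc0 C s; positivity, fun g => ?_⟩, ?_⟩
  · rw [← mul_sum, div_mul_eq_mul_div, le_div_iff₀ hpos, one_mul]
    exact hcol g
  · have : dotM M (fun C s => w / (-v) * c C s) e = w / (-v) * dotM M c e := by
      simp only [dotM, mul_sum, mul_assoc]
    rw [this, div_mul_eq_mul_div, div_le_iff₀ hpos]
    gcongr

lemma exists_dualFeasible_minimal {M : Finset (Finset X)} (hM : M.Nonempty)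
    {e : ∀ C : Finset X, Assign C O → ℝ} (he : ∀ C ∈ M, ∀ s, 0 ≤ e C s) :
    ∃ y, DualFeasible M y ∧ ∀ y', DualFeasible M y' → dotM M y e ≤ dotM M y' e := by
  let K : Set (∀ C : Finset X, Assign C O → ℝ) :=
    Set.Icc 0 1 ∩ {y | ∀ g : X → O, 1 ≤ ∑ C ∈ M, y C (restrictTo C g)}
  have hK : IsCompact K := by
    refine isCompact_Icc.inter_right ?_
    simp only [Set.ofPred_forall]
    exact isClosed_iInter fun g => isClosed_le continuous_const (by fun_prop)
  have hKne : K.Nonempty := by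
    refine ⟨1, ⟨zero_le_one, le_rfl⟩, fun g => ?_⟩
    simpa using hM.card_pos
  obtain ⟨y, hy, hmin⟩ := hK.exists_isMinOn hKne
    (f := fun y => dotM M y e) (by unfold dotM; fun_prop)
  refine ⟨y, ⟨fun C s => hy.1.1 C s, hy.2⟩, fun y' hy' => ?_⟩
  have hmem : (fun C s => min (y' C s) 1) ∈ K := by
    refine ⟨⟨fun C s => le_min (hy'.1 C s) zero_le_one, fun C s => min_le_right _ _⟩, fun g => ?_⟩
    by_cases hg : ∃ C ∈ M, 1 ≤ y' C (restrictTo C g)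
    · obtain ⟨C, hC, h1⟩ := hg
      have := single_le_sum (f := fun C => min (y' C (restrictTo C g)) 1)
        (fun D _ => le_min (hy'.1 D _) zero_le_one) hC
      simpa only [min_eq_right h1] using this
    · push Not at hg
      rw [sum_congr rfl fun C hC => min_eq_left (hg C hC).le]
      exact hy'.2 g
  exact (hmin hmem).trans (sum_le_sum fun C hC => sum_le_sum fun s _ =>
    mul_le_mul_of_nonneg_right (min_le_left _ _) (he C hC s))

lemma bddAbove_feasible_weights (M : Finset (Finset X)) (e : ∀ C : Finset X, Assign C O → ℝ) :
    BddAbove {w | ∃ b : (X → O) → ℝ, Feasible M e b ∧ ∑ g, b g = w} :=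
  ⟨1, by rintro _ ⟨b, hb, rfl⟩; exact hb.2.1⟩

lemma Feasible.sum_le_NCF {M : Finset (Finset X)} {e : ∀ C : Finset X, Assign C O → ℝ}
    {b : (X → O) → ℝ} (hb : Feasible M e b) : ∑ g, b g ≤ NCF M e :=
  le_csSup (bddAbove_feasible_weights M e) ⟨b, hb, rfl⟩

lemma feasible_zero {M : Finset (Finset X)} {e : ∀ C : Finset X, Assign C O → ℝ}
    (he : ∀ C ∈ M, ∀ s, 0 ≤ e C s) : Feasible M e 0 :=
  ⟨fun _ => le_rfl, by simp, fun C hC t => by simpa [margG] using he C hC t⟩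

lemma DualFeasible.NCF_le_dotM {M : Finset (Finset X)} {y e : ∀ C : Finset X, Assign C O → ℝ}
    (hy : DualFeasible M y) (he : ∀ C ∈ M, ∀ s, 0 ≤ e C s) : NCF M e ≤ dotM M y e := by
  refine csSup_le ⟨_, 0, feasible_zero he, rfl⟩ ?_
  rintro _ ⟨b, hb, rfl⟩
  exact hy.sum_le_dotM hb.1 hb.2.2

lemma nonempty_of_CF_pos [Nonempty O] {M : Finset (Finset X)}
    {e : ∀ C : Finset X, Assign C O → ℝ} (hCF : 0 < CF M e) : M.Nonempty := by
  by_contra hM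
  rw [not_nonempty_iff_eq_empty] at hM
  subst hM
  have g : X → O := fun _ => Classical.arbitrary O
  have h1 := Feasible.sum_le_NCF (M := ∅) (e := e) (b := Pi.single g 1)
    ⟨(single_mem_stdSimplex ℝ g).1, by simp, by simp⟩
  simp only [CF] at hCF
  simp at h1
  linarith

/-- Strong duality for the linear program defining `NCF`, with an attained dual optimum. -/
lemma exists_dualFeasible_dotM_eq_NCF [Nonempty O] {M : Finset (Finset X)} (hM : M.Nonempty)
    {e : ∀ C : Finset X, Assign C O → ℝ} (he : ∀ C ∈ M, IsProb (e C)) :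
    ∃ y, DualFeasible M y ∧ dotM M y e = NCF M e := by
  have he0 : ∀ C ∈ M, ∀ s, 0 ≤ e C s := fun C hC => (he C hC).1
  obtain ⟨y, hy, hmin⟩ := exists_dualFeasible_minimal hM he0
  refine ⟨y, hy, le_antisymm (le_of_forall_gt_imp_ge_of_dense fun w hw => ?_) ?_⟩
  · have hN : 0 ≤ NCF M e := by simpa using (feasible_zero he0).sum_le_NCF
    obtain ⟨y', hy', hle⟩ := exists_dualFeasible_dotM_le he0 (hN.trans_lt hw)
      fun b hb hbe => by
        obtain ⟨C, hC⟩ := hM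
        refine lt_of_le_of_lt (Feasible.sum_le_NCF ⟨hb, ?_, hbe⟩) hw
        rw [← sum_margG C, ← (he C hC).2]
        exact sum_le_sum fun s _ => hbe C hC s
    exact (hmin y' hy').trans hle
  · exact hy.NCF_le_dotM he0

/-- If `NCF < 1`, the minimal entries of a dual optimum over the contexts sum to zero. -/
lemma DualFeasible.sum_inf'_eq_zero [Nonempty O] {M : Finset (Finset X)}
    {y e : ∀ C : Finset X, Assign C O → ℝ} (he : ∀ C ∈ M, IsProb (e C))
    (hy : DualFeasible M y) (hye : dotM M y e = NCF M e) (hlt : NCF M e < 1) :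
    ∑ C ∈ M, (univ : Finset (Assign C O)).inf' univ_nonempty (y C) = 0 := by
  set m : Finset X → ℝ := fun C => (univ : Finset (Assign C O)).inf' univ_nonempty (y C)
  have hle (C : Finset X) (s : Assign C O) : m C ≤ y C s := inf'_le _ (mem_univ s)
  have hm0 : 0 ≤ ∑ C ∈ M, m C := sum_nonneg fun C _ => le_inf' _ _ fun s _ => hy.1 C s
  have hdot := dotM_const_sub (fun C hC => (he C hC).2) m y
  have hnonpos : dotM M (fun C s => m C - y C s) e ≤ 0 :=
    sum_nonpos fun C hC => sum_nonpos fun s _ =>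
      mul_nonpos_of_nonpos_of_nonneg (sub_nonpos.2 (hle C s)) ((he C hC).1 s)
  have hpos : 0 < 1 - ∑ C ∈ M, m C := by linarith
  have hy' : DualFeasible M (fun C s => -(1 - ∑ C ∈ M, m C)⁻¹ * (m C - y C s)) := by
    refine ⟨fun C s => ?_, fun g => ?_⟩
    · beta_reduce
      rw [neg_mul_comm, neg_sub]
      exact mul_nonneg (inv_nonneg.2 hpos.le) (sub_nonneg.2 (hle C s))
    · rw [← mul_sum, neg_mul_comm, inv_mul_eq_div, le_div_iff₀ hpos, sum_sub_distrib]
      linarith [hy.2 g]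
  have h1 := hy'.NCF_le_dotM fun C hC => (he C hC).1
  have h2 : dotM M (fun C s => -(1 - ∑ C ∈ M, m C)⁻¹ * (m C - y C s)) e
      = -(1 - ∑ C ∈ M, m C)⁻¹ * dotM M (fun C s => m C - y C s) e := by
    simp only [dotM, mul_sum, mul_assoc]
  rw [h2, neg_mul_comm, inv_mul_eq_div, le_div_iff₀ hpos, hdot, hye] at h1
  nlinarith

/-- **Theorem 1(ii).** For any empirical model with `CF(e) > 0` there is a
Bell inequality `(a, 0)` with algebraic bound `‖a‖ = 1` whose (normalised) violation by
`e` is exactly `CF(e)`. -/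
theorem exists_bell_inequality_with_violation_eq_CF
    {X O : Type} [Fintype X] [DecidableEq X] [Fintype O] [DecidableEq O] [Nonempty O]
    (M : Finset (Finset X)) (e : ∀ C : Finset X, Assign C O → ℝ)
    (he : IsEmpiricalModel M e) (hCF : 0 < CF M e) :
    ∃ a : ∀ C : Finset X, Assign C O → ℝ,
      (∀ e' : ∀ C : Finset X, Assign C O → ℝ,
        IsEmpiricalModel M e' → NonContextual M e' → dotM M a e' ≤ 0) ∧
      normM M a = 1 ∧
      dotM M a e = CF M e := by
  have hM := nonempty_of_CF_pos hCF
  obtain ⟨y, hy, hye⟩ := exists_dualFeasible_dotM_eq_NCF hM he.1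
  have hlt : NCF M e < 1 := sub_pos.1 hCF
  have hcard : ∑ _C ∈ M, (#M : ℝ)⁻¹ = 1 := by
    rw [sum_const, nsmul_eq_mul, mul_inv_cancel₀ (Nat.cast_ne_zero.2 hM.card_pos.ne')]
  refine ⟨fun C s => (#M : ℝ)⁻¹ - y C s, fun e' he' hnc => ?_, ?_, ?_⟩
  · rw [dotM_const_sub (fun C hC => (he'.1 C hC).2) (fun _ => (#M : ℝ)⁻¹), hcard, sub_nonpos]
    obtain ⟨d, hd, hde⟩ := hnc
    rw [← hd.2]
    exact hy.sum_le_dotM hd.1 fun C hC t => (congrFun (hde C hC) t).le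
  · have hsup (C : Finset X) : (univ : Finset (Assign C O)).sup' univ_nonempty
        (fun s => (#M : ℝ)⁻¹ - y C s)
        = (#M : ℝ)⁻¹ - (univ : Finset (Assign C O)).inf' univ_nonempty (y C) := by
      refine le_antisymm (sup'_le _ _ fun s _ => sub_le_sub_left (inf'_le _ (mem_univ s)) _) ?_
      obtain ⟨s, -, hs⟩ := exists_mem_eq_inf' (univ_nonempty (α := Assign C O)) (y C)
      rw [hs]
      exact le_sup' (fun s => (#M : ℝ)⁻¹ - y C s) (mem_univ s)
    simp only [normM, hsup]
    rw [sum_sub_distrib, hcard, hy.sum_inf'_eq_zero he.1 hye hlt, sub_zero]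
  · rw [dotM_const_sub (fun C hC => (he.1 C hC).2) (fun _ => (#M : ℝ)⁻¹), hcard, hye, CF]
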